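/- Fix n, D, and parameters p₁,…,p_D ∈ [0,1). Let 𝔍 be the random monomial ideal of the graded model 𝒢(n,D,𝐩), in which each monomial of degree d (1 ≤ d ≤ D) is included in the random generating set 𝔅 independently with probability p_d. Then for any fixed proper monomial ideal I ⊆ S all of whose minimal generators have degree at most D, P(𝔍 = I) = ∏_{d=1}^{D} p_d^{β_{1,d}(S/I)} · (1−p_d)^{h_I(d)}. -/

import Mathlib

open Finset MvPolynomial Filter

noncomputable section

/-- The set of exponent vectors of nonconstant monomials in `n` variables of total degree
at most `D`. -/
def monSet (n D : ℕ) : Finset (Fin n → ℕ) :=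
  (Fintype.piFinset fun _ : Fin n => Finset.range (D + 1)).filter
    fun α => 0 < ∑ i, α i ∧ ∑ i, α i ≤ D

/-- The monomial `x^α` of `MvPolynomial (Fin n) K` with exponent vector `α`. -/
def mono (K : Type*) [CommRing K] {n : ℕ} (α : Fin n → ℕ) : MvPolynomial (Fin n) K :=
  MvPolynomial.monomial (Finsupp.equivFunOnFinite.symm α) 1

/-- The monomial ideal generated by a set of exponent vectors. -/
def idealOf (K : Type*) [CommRing K] {n : ℕ} (B : Finset (Fin n → ℕ)) :
    Ideal (MvPolynomial (Fin n) K) :=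
  Ideal.span (mono K '' (B : Set (Fin n → ℕ)))

open Classical in
/-- The probability, under the ER-type model `ℐ(n,D,p)`, of the event `E` on random
generating sets `𝔅 ⊆ M(n,D)`. -/
def ERprob (n D : ℕ) (p : ℝ) (E : Set (Finset (Fin n → ℕ))) : ℝ :=
  ∑ B ∈ (monSet n D).powerset.filter (· ∈ E),
    p ^ B.card * (1 - p) ^ ((monSet n D).card - B.card)

/-- `I` is a monomial ideal. -/
def IsMonomialIdeal (K : Type*) [CommRing K] {n : ℕ}
    (I : Ideal (MvPolynomial (Fin n) K)) : Prop :=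
  ∃ G : Set (Fin n → ℕ), I = Ideal.span (mono K '' G)

/-- `x^α` is a minimal monomial generator of `I`: it lies in `I` and no proper divisor does. -/
def IsMinGen (K : Type*) [CommRing K] {n : ℕ} (I : Ideal (MvPolynomial (Fin n) K))
    (α : Fin n → ℕ) : Prop :=
  mono K α ∈ I ∧ ∀ β : Fin n → ℕ, (∀ i, β i ≤ α i) → β ≠ α → mono K β ∉ I

/-- `β₁(S/I)`: the number of minimal monomial generators of `I`. -/
def beta1 (K : Type*) [CommRing K] {n : ℕ} (I : Ideal (MvPolynomial (Fin n) K)) : ℕ :=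
  {α : Fin n → ℕ | IsMinGen K I α}.ncard

/-- `β_{1,d}(S/I)`: the number of minimal monomial generators of `I` of degree `d`. -/
def beta1d (K : Type*) [CommRing K] {n : ℕ} (I : Ideal (MvPolynomial (Fin n) K)) (d : ℕ) : ℕ :=
  {α : Fin n → ℕ | IsMinGen K I α ∧ ∑ i, α i = d}.ncard

/-- `h_I(d)`: the number of monomials of degree exactly `d` not contained in `I`. -/
def hilb (K : Type*) [CommRing K] {n : ℕ} (I : Ideal (MvPolynomial (Fin n) K)) (d : ℕ) : ℕ :=
  {α : Fin n → ℕ | ∑ i, α i = d ∧ mono K α ∉ I}.ncard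

open Classical in
/-- The probability, under the graded model `𝒢(n,D,𝐩)` (each monomial of degree `d` is
included in the random generating set independently with probability `p d`), of the
event `E` on random generating sets `𝔅 ⊆ M(n,D)`. -/
def gradedProb (n D : ℕ) (p : ℕ → ℝ) (E : Set (Finset (Fin n → ℕ))) : ℝ :=
  ∑ B ∈ (monSet n D).powerset.filter (· ∈ E),
    (∏ α ∈ B, p (∑ i, α i)) * ∏ α ∈ monSet n D \ B, (1 - p (∑ i, α i))

theorem mem_monSet {n D : ℕ} {α : Fin n → ℕ} :
    α ∈ monSet n D ↔ 0 < ∑ i, α i ∧ ∑ i, α i ≤ D := by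
  simp only [monSet, Finset.mem_filter, Fintype.mem_piFinset, Finset.mem_range,
    and_iff_right_iff_imp]
  intro h i
  have := Finset.single_le_sum (f := α) (fun _ _ => Nat.zero_le _) (Finset.mem_univ i)
  omega

theorem mono_mem_span_iff (K : Type*) [Field K] {n : ℕ} {G : Set (Fin n → ℕ)}
    {α : Fin n → ℕ} : mono K α ∈ Ideal.span (mono K '' G) ↔ ∃ β ∈ G, β ≤ α := by
  have h : mono K '' G =
      (fun s => MvPolynomial.monomial s (1 : K)) '' (Finsupp.equivFunOnFinite.symm '' G) := by
    rw [Set.image_image]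
    rfl
  classical
  rw [h, MvPolynomial.mem_ideal_span_monomial_image]
  simp only [mono, MvPolynomial.support_monomial, one_ne_zero, if_false, Finset.mem_singleton,
    forall_eq, Set.exists_mem_image]
  rfl

theorem mono_mem_of_le (K : Type*) [CommRing K] {n : ℕ}
    {I : Ideal (MvPolynomial (Fin n) K)} {α β : Fin n → ℕ} (h : β ≤ α)
    (hβ : mono K β ∈ I) : mono K α ∈ I := by
  refine Ideal.mem_of_dvd I ?_ hβ
  refine MvPolynomial.monomial_dvd_monomial.2 ⟨Or.inr ?_, dvd_rfl⟩
  exact h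

theorem exists_isMinGen_le (K : Type*) [CommRing K] {n : ℕ}
    {I : Ideal (MvPolynomial (Fin n) K)} {α : Fin n → ℕ} (h : mono K α ∈ I) :
    ∃ β ≤ α, IsMinGen K I β := by
  obtain ⟨β, hle, hβ⟩ := exists_minimal_le_of_wellFoundedLT (fun β => mono K β ∈ I) α h
  exact ⟨β, hle, hβ.prop, fun γ hγ hne hmem => hne (hβ.eq_of_le hmem hγ)⟩

theorem idealOf_eq_iff (K : Type*) [Field K] {n : ℕ} {I : Ideal (MvPolynomial (Fin n) K)}
    (hmon : IsMonomialIdeal K I) (B : Finset (Fin n → ℕ)) :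
    idealOf K B = I ↔ (∀ α, IsMinGen K I α → α ∈ B) ∧ ∀ α ∈ B, mono K α ∈ I := by
  constructor
  · rintro rfl
    have hB : ∀ α ∈ B, mono K α ∈ idealOf K B := fun α hα =>
      Ideal.subset_span (Set.mem_image_of_mem _ hα)
    refine ⟨fun α hα => ?_, hB⟩
    obtain ⟨β, hβ, hle⟩ := (mono_mem_span_iff K).1 hα.1
    by_contra hne
    exact hα.2 β hle (fun h => hne (h ▸ hβ)) (hB β hβ)
  · rintro ⟨hgen, hmem⟩
    apply le_antisymm
    · rw [idealOf, Ideal.span_le]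
      rintro _ ⟨α, hα, rfl⟩
      exact hmem α hα
    · obtain ⟨G, hG⟩ := hmon
      conv_lhs => rw [hG]
      rw [Ideal.span_le]
      rintro _ ⟨α, hα, rfl⟩
      have hαI : mono K α ∈ I := hG ▸ Ideal.subset_span (Set.mem_image_of_mem _ hα)
      obtain ⟨β, hle, hβ⟩ := exists_isMinGen_le K hαI
      exact (mono_mem_span_iff K).2 ⟨β, hgen β hβ, hle⟩

/-- The total weight of the subsets between `G` and `H` in a product Bernoulli model on `M`. -/
theorem sum_powerset_between {ι : Type*} [DecidableEq ι] {M G H : Finset ι}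
    (hGH : G ⊆ H) (hHM : H ⊆ M) (q : ι → ℝ) :
    ∑ B ∈ M.powerset with G ⊆ B ∧ B ⊆ H, (∏ i ∈ B, q i) * ∏ i ∈ M \ B, (1 - q i) =
      (∏ i ∈ G, q i) * ∏ i ∈ M \ H, (1 - q i) := by
  have key := Finset.prod_add (fun i => if i ∈ H then q i else 0)
    (fun i => if i ∈ G then 0 else 1 - q i) M
  have hlhs : ∏ i ∈ M, ((if i ∈ H then q i else 0) + if i ∈ G then 0 else 1 - q i) =
      (∏ i ∈ G, q i) * ∏ i ∈ M \ H, (1 - q i) := by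
    rw [← Finset.prod_sdiff hHM, ← Finset.prod_sdiff hGH, mul_comm]
    congr 1
    · rw [Finset.prod_eq_one, one_mul]
      · refine Finset.prod_congr rfl fun i hi => ?_
        simp [hi, hGH hi]
      · intro i hi
        rw [Finset.mem_sdiff] at hi
        simp [hi.1, hi.2]
    · refine Finset.prod_congr rfl fun i hi => ?_
      rw [Finset.mem_sdiff] at hi
      have hiG : i ∉ G := fun h => hi.2 (hGH h)
      simp [hi.2, hiG]
  rw [← hlhs, key, Finset.sum_filter]
  refine Finset.sum_congr rfl fun B hB => ?_
  rw [Finset.mem_powerset] at hB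
  split_ifs with h
  · congr 1
    · exact Finset.prod_congr rfl fun i hi => by simp [h.2 hi]
    · refine Finset.prod_congr rfl fun i hi => ?_
      have hiG : i ∉ G := fun hG => (Finset.mem_sdiff.1 hi).2 (h.1 hG)
      simp [hiG]
  · rw [not_and_or, Finset.not_subset, Finset.not_subset] at h
    rcases h with ⟨i, hG, hB'⟩ | ⟨i, hB', hH⟩
    · rw [Finset.prod_eq_zero (s := M \ B) (i := i)
        (Finset.mem_sdiff.2 ⟨hHM (hGH hG), hB'⟩) (by simp [hG]), mul_zero]
    · rw [Finset.prod_eq_zero (s := B) (i := i) hB' (by simp [hH]), zero_mul]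

theorem prod_degree_eq {n D : ℕ} {A : Finset (Fin n → ℕ)} (hA : A ⊆ monSet n D)
    (q : ℕ → ℝ) :
    ∏ α ∈ A, q (∑ i, α i) = ∏ d ∈ Finset.Icc 1 D, q d ^ #{α ∈ A | ∑ i, α i = d} := by
  rw [← Finset.prod_fiberwise_of_maps_to (t := Finset.Icc 1 D) (g := fun α : Fin n → ℕ => ∑ i, α i)
    fun α hα => Finset.mem_Icc.2 (mem_monSet.1 (hA hα))]
  refine Finset.prod_congr rfl fun d _ => ?_
  exact Finset.prod_eq_pow_card fun α hα => by rw [(Finset.mem_filter.1 hα).2]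

theorem isMinGen_degree_pos (K : Type*) [CommRing K] {n : ℕ}
    {I : Ideal (MvPolynomial (Fin n) K)} (hproper : I ≠ ⊤) {α : Fin n → ℕ}
    (h : IsMinGen K I α) : 0 < ∑ i, α i := by
  by_contra h0
  have hα : α = 0 := by
    funext i
    simpa using (Finset.sum_eq_zero_iff.1 (Nat.eq_zero_of_not_pos h0)) i (Finset.mem_univ i)
  have h1 : mono K α = 1 := by
    subst hα
    have h0 : Finsupp.equivFunOnFinite.symm (0 : Fin n → ℕ) = 0 := by
      ext
      simp
    rw [mono, h0]
    rfl
  exact hproper ((Ideal.eq_top_iff_one I).2 (h1 ▸ h.1))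

/-- Theorem 5.1. Under the graded model with parameters
`p₁,…,p_D ∈ [0,1)`, for any fixed proper monomial ideal `I` all of whose minimal
generators have degree at most `D`,
`P(𝔍 = I) = ∏_{d=1}^D p_d^{β_{1,d}(S/I)} (1-p_d)^{h_I(d)}`. -/
theorem stmt18 (K : Type*) [Field K] (n D : ℕ) (hn : 1 ≤ n) (hD : 1 ≤ D)
    (p : ℕ → ℝ) (hp : ∀ d ∈ Finset.Icc 1 D, 0 ≤ p d ∧ p d < 1)
    (I : Ideal (MvPolynomial (Fin n) K)) (hmon : IsMonomialIdeal K I) (hproper : I ≠ ⊤)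
    (hdeg : ∀ α : Fin n → ℕ, IsMinGen K I α → ∑ i, α i ≤ D) :
    gradedProb n D p {B | idealOf K B = I} =
      ∏ d ∈ Finset.Icc 1 D, p d ^ beta1d K I d * (1 - p d) ^ hilb K I d := by
  classical
  set M := monSet n D with hM
  set G := M.filter (IsMinGen K I)
  set H := M.filter (fun α => mono K α ∈ I)
  have hG {α} : α ∈ G ↔ IsMinGen K I α := by
    simp only [G, Finset.mem_filter, and_iff_right_iff_imp]
    exact fun h => mem_monSet.2 ⟨isMinGen_degree_pos K hproper h, hdeg α h⟩
  have hGH : G ⊆ H := fun α hα =>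
    Finset.mem_filter.2 ⟨(Finset.mem_filter.1 hα).1, (hG.1 hα).1⟩
  have hHM : H ⊆ M := Finset.filter_subset _ _
  have hfilter : M.powerset.filter (· ∈ {B | idealOf K B = I}) =
      M.powerset.filter (fun B => G ⊆ B ∧ B ⊆ H) := by
    refine Finset.filter_congr fun B hB => ?_
    rw [Finset.mem_powerset] at hB
    rw [Set.mem_ofPred_eq, idealOf_eq_iff K hmon]
    refine and_congr ⟨fun h α hα => h α (hG.1 hα), fun h α hα => h (hG.2 hα)⟩ ?_
    exact ⟨fun h α hα => Finset.mem_filter.2 ⟨hB hα, h α hα⟩,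
      fun h α hα => (Finset.mem_filter.1 (h hα)).2⟩
  have hsum : gradedProb n D p {B | idealOf K B = I} =
      (∏ α ∈ G, p (∑ i, α i)) * ∏ α ∈ M \ H, (1 - p (∑ i, α i)) := by
    rw [← sum_powerset_between hGH hHM, ← hfilter, gradedProb]
    congr!
  rw [hsum, prod_degree_eq (hGH.trans hHM),
    prod_degree_eq (Finset.sdiff_subset : M \ H ⊆ M) (fun d => 1 - p d),
    ← Finset.prod_mul_distrib]
  refine Finset.prod_congr rfl fun d hd => ?_
  rw [Finset.mem_Icc] at hd
  congr 2
  · rw [beta1d, ← Set.ncard_coe_finset]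
    congr 1
    ext α
    simp [hG]
  · rw [hilb, ← Set.ncard_coe_finset]
    congr 1
    ext α
    simp only [Finset.coe_filter, Finset.mem_sdiff, Set.mem_ofPred_eq, H, Finset.mem_filter,
      hM, mem_monSet]
    constructor
    · tauto
    · rintro ⟨rfl, h⟩
      tauto

end
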